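/- arXiv:1108.5764 — 3 statements merged into one kernel-verified Lean document; each statement's English description precedes it below -/
import Mathlib

section
/- The function α ↦ B(α) is affine in α: there exist real constants p and q, depending only on σ₀, ε₀, S₁, S₂, f₁, f₂ (not on α), such that B(α) = p + qα for all α ∈ ℝ; equivalently, upon expanding (f₁L₂(α) + f₂L₁(α)) e₀(α) − L₁(α)L₂(α)σ₀, the coefficient of α² vanishes. -/
open MeasureTheory Matrix

/-- The translation matrix `T = diag(1, −1, −1)`: in the orthonormal basis of 2×2 symmetric
matrices, the determinant of the matrix represented by `v` is `½ v·Tv`. -/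
noncomputable def Tmat : Matrix (Fin 3) (Fin 3) ℝ := Matrix.diagonal ![1, -1, -1]

/-- The compliance matrix of an isotropic phase with bulk modulus `κ` and shear modulus `μ`,
`S = ½ diag(1/κ, 1/μ, 1/μ)`. -/
noncomputable def Sph (κ μ : ℝ) : Matrix (Fin 3) (Fin 3) ℝ :=
  Matrix.diagonal ![1 / (2 * κ), 1 / (2 * μ), 1 / (2 * μ)]

/-- The local compliance `S = χ₁ S₁ + χ₂ S₂`. -/
noncomputable def Smix (κ₁ κ₂ μ₁ μ₂ χ : ℝ) : Matrix (Fin 3) (Fin 3) ℝ :=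
  χ • Sph κ₁ μ₁ + (1 - χ) • Sph κ₂ μ₂

/-- The bound expression
`B(α) = (1/(f₁f₂)) ((S₁−S₂)⁻¹)² (ε₀ − ⟨S⟩σ₀) · ((f₁L₂(α) + f₂L₁(α)) e₀(α) − L₁(α)L₂(α)σ₀)`,
with `Lᵢ(α) = Sᵢ − αT` and `e₀(α) = ε₀ − αTσ₀`. -/
noncomputable def Bexpr (f₁ f₂ : ℝ) (S₁ S₂ : Matrix (Fin 3) (Fin 3) ℝ)
    (σ₀ ε₀ : Fin 3 → ℝ) (α : ℝ) : ℝ :=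
  (1 / (f₁ * f₂)) *
    (((((S₁ - S₂)⁻¹) ^ 2).mulVec (ε₀ - (f₁ • S₁ + f₂ • S₂).mulVec σ₀)) ⬝ᵥ
      ((f₁ • (S₂ - α • Tmat) + f₂ • (S₁ - α • Tmat)).mulVec (ε₀ - α • Tmat.mulVec σ₀) -
        ((S₁ - α • Tmat) * (S₂ - α • Tmat)).mulVec σ₀))


/-- The quadratic terms in `α` cancel because the weights `f` and `1 - f` sum to one. -/
theorem translated_bound_vector_affine {n : Type*} [Fintype n] (f α : ℝ)
    (A B T : Matrix n n ℝ) (s e : n → ℝ) :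
    (f • (B - α • T) + (1 - f) • (A - α • T)) *ᵥ (e - α • T *ᵥ s) -
        ((A - α • T) * (B - α • T)) *ᵥ s =
      ((f • B + (1 - f) • A) *ᵥ e - (A * B) *ᵥ s) +
        α • ((A * T + T * B - (f • B + (1 - f) • A) * T) *ᵥ s - T *ᵥ e) := by
  simp only [sub_mul, mul_sub, add_mul, Matrix.smul_mul, Matrix.mul_smul, add_mulVec, sub_mulVec,
    mulVec_sub, smul_mulVec, mulVec_smul, mulVec_mulVec]
  module

/-- The function `α ↦ B(α)` is affine in `α`: there exist real constants `p`, `q`,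
depending only on `σ₀, ε₀, S₁, S₂, f₁, f₂` (not on `α`), with `B(α) = p + qα` for all `α`. -/
theorem stmt2 (κ₁ κ₂ μ₁ μ₂ : ℝ) (hκ₁ : 0 < κ₁) (hκ₂ : 0 < κ₂) (hμ₁ : 0 < μ₁) (hμ₂ : 0 < μ₂)
    (hκ : κ₁ ≠ κ₂) (hμ : μ₁ ≠ μ₂)
    (f₁ : ℝ) (hf₁0 : 0 < f₁) (hf₁1 : f₁ < 1)
    (σ₀ ε₀ : Fin 3 → ℝ) :
    ∃ p q : ℝ, ∀ α : ℝ,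
      Bexpr f₁ (1 - f₁) (Sph κ₁ μ₁) (Sph κ₂ μ₂) σ₀ ε₀ α = p + q * α := by
  exact ⟨_, _, fun α => by
    rw [Bexpr, translated_bound_vector_affine, dotProduct_add, dotProduct_smul, smul_eq_mul,
      mul_add, mul_left_comm, mul_comm α]⟩
end

section
/- One has ν₅ = αν₃ + βν₄ with α = −κ₂(κ₁+μ₁)(κ₁+μ₂)/((κ₁−κ₂)μ₁μ₂) < 0 and β = −κ₁(κ₂+μ₁)(κ₂+μ₂)/((κ₁−κ₂)μ₁μ₂) < 0; consequently there exist nonnegative reals α₁, α₂, α₃, not all zero, with α₁ν₃ + α₂ν₄ + α₃ν₅ = 0 (the triplet of outward normals (ν₃, ν₄, ν₅) always satisfies the cone condition). -/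
/-- With κ₁ > κ₂ > 0, μ₁, μ₂ > 0 and the outward normals
ν₃ = (−κ₂−μ₁, −κ₂−μ₂), ν₄ = (κ₁+μ₁, κ₁+μ₂),
ν₅ = (−(κ₁+μ₁)(κ₂+μ₁)/μ₁, −(κ₁+μ₂)(κ₂+μ₂)/μ₂), one has
ν₅ = α ν₃ + β ν₄ with α = −κ₂(κ₁+μ₁)(κ₁+μ₂)/((κ₁−κ₂)μ₁μ₂) < 0 and
β = −κ₁(κ₂+μ₁)(κ₂+μ₂)/((κ₁−κ₂)μ₁μ₂) < 0; consequently there exist nonnegative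
α₁, α₂, α₃, not all zero, with α₁ν₃ + α₂ν₄ + α₃ν₅ = 0. -/
theorem stmt16 (κ₁ κ₂ μ₁ μ₂ : ℝ) (hκ : κ₂ < κ₁) (hκ₂ : 0 < κ₂)
    (hμ₁ : 0 < μ₁) (hμ₂ : 0 < μ₂)
    (ν₃ ν₄ ν₅ : ℝ × ℝ)
    (hν₃ : ν₃ = (-κ₂ - μ₁, -κ₂ - μ₂))
    (hν₄ : ν₄ = (κ₁ + μ₁, κ₁ + μ₂))
    (hν₅ : ν₅ = (-((κ₁ + μ₁) * (κ₂ + μ₁) / μ₁), -((κ₁ + μ₂) * (κ₂ + μ₂) / μ₂))) :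
    (ν₅ = (-(κ₂ * (κ₁ + μ₁) * (κ₁ + μ₂) / ((κ₁ - κ₂) * μ₁ * μ₂))) • ν₃ +
          (-(κ₁ * (κ₂ + μ₁) * (κ₂ + μ₂) / ((κ₁ - κ₂) * μ₁ * μ₂))) • ν₄) ∧
    (-(κ₂ * (κ₁ + μ₁) * (κ₁ + μ₂) / ((κ₁ - κ₂) * μ₁ * μ₂)) < 0) ∧
    (-(κ₁ * (κ₂ + μ₁) * (κ₂ + μ₂) / ((κ₁ - κ₂) * μ₁ * μ₂)) < 0) ∧
    ∃ α₁ α₂ α₃ : ℝ, 0 ≤ α₁ ∧ 0 ≤ α₂ ∧ 0 ≤ α₃ ∧ ¬(α₁ = 0 ∧ α₂ = 0 ∧ α₃ = 0) ∧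
      α₁ • ν₃ + α₂ • ν₄ + α₃ • ν₅ = 0 := by
  have hd : 0 < κ₁ - κ₂ := sub_pos.mpr hκ
  have hκ₁ : 0 < κ₁ := hκ₂.trans hκ
  have hα : -(κ₂ * (κ₁ + μ₁) * (κ₁ + μ₂) / ((κ₁ - κ₂) * μ₁ * μ₂)) < 0 :=
    neg_neg_of_pos (by positivity)
  have hβ : -(κ₁ * (κ₂ + μ₁) * (κ₂ + μ₂) / ((κ₁ - κ₂) * μ₁ * μ₂)) < 0 :=
    neg_neg_of_pos (by positivity)
  have hcomb : ν₅ = (-(κ₂ * (κ₁ + μ₁) * (κ₁ + μ₂) / ((κ₁ - κ₂) * μ₁ * μ₂))) • ν₃ +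
      (-(κ₁ * (κ₂ + μ₁) * (κ₂ + μ₂) / ((κ₁ - κ₂) * μ₁ * μ₂))) • ν₄ := by
    have hd' := hd.ne'
    subst hν₃ hν₄ hν₅
    ext
    · simp only [Prod.fst_add, Prod.smul_fst, smul_eq_mul]
      field_simp
      ring
    · simp only [Prod.snd_add, Prod.smul_snd, smul_eq_mul]
      field_simp
      ring
  refine ⟨hcomb, hα, hβ, _, _, 1, neg_nonneg.mpr hα.le, neg_nonneg.mpr hβ.le, zero_le_one,
    fun h => one_ne_zero h.2.2, ?_⟩
  rw [one_smul, hcomb]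
  module
end

section
/- If the pair (α, β) ∈ ℝ² satisfies ν₅ = αν₁ + βν₄, then α = −κ₂(μ₁−μ₂)(κ₁+μ₁)/(μ₁μ₂) and β = −(κ₂+μ₂)/μ₂; in particular β < 0 always, and α ≤ 0 if and only if μ₁ ≥ μ₂, so the triplet of outward normals (ν₁, ν₄, ν₅) admits a representation ν₅ = αν₁ + βν₄ with α ≤ 0 and β ≤ 0 if and only if μ₁ ≥ μ₂. -/
/-- With κ₁ > κ₂ > 0, μ₁, μ₂ > 0, ν₁ = (−1,0), ν₄ = (κ₁+μ₁, κ₁+μ₂),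
ν₅ = (−(κ₁+μ₁)(κ₂+μ₁)/μ₁, −(κ₁+μ₂)(κ₂+μ₂)/μ₂): if ν₅ = αν₁ + βν₄ then
α = −κ₂(μ₁−μ₂)(κ₁+μ₁)/(μ₁μ₂) and β = −(κ₂+μ₂)/μ₂; in particular β < 0 always,
α ≤ 0 ↔ μ₁ ≥ μ₂, and (ν₁, ν₄, ν₅) admits a representation ν₅ = αν₁ + βν₄ with
α ≤ 0 and β ≤ 0 if and only if μ₁ ≥ μ₂. -/
theorem stmt17 (κ₁ κ₂ μ₁ μ₂ : ℝ) (hκ : κ₂ < κ₁) (hκ₂ : 0 < κ₂)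
    (hμ₁ : 0 < μ₁) (hμ₂ : 0 < μ₂)
    (ν₁ ν₄ ν₅ : ℝ × ℝ)
    (hν₁ : ν₁ = (-1, 0))
    (hν₄ : ν₄ = (κ₁ + μ₁, κ₁ + μ₂))
    (hν₅ : ν₅ = (-((κ₁ + μ₁) * (κ₂ + μ₁) / μ₁), -((κ₁ + μ₂) * (κ₂ + μ₂) / μ₂))) :
    (∀ α β : ℝ, ν₅ = α • ν₁ + β • ν₄ →
        α = -(κ₂ * (μ₁ - μ₂) * (κ₁ + μ₁) / (μ₁ * μ₂)) ∧ β = -((κ₂ + μ₂) / μ₂)) ∧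
    (-((κ₂ + μ₂) / μ₂) < 0) ∧
    (-(κ₂ * (μ₁ - μ₂) * (κ₁ + μ₁) / (μ₁ * μ₂)) ≤ 0 ↔ μ₂ ≤ μ₁) ∧
    ((∃ α β : ℝ, α ≤ 0 ∧ β ≤ 0 ∧ ν₅ = α • ν₁ + β • ν₄) ↔ μ₂ ≤ μ₁) := by
  subst hν₁ hν₄ hν₅
  have hκ₁ : 0 < κ₁ := hκ₂.trans hκ
  have hrep : ∀ α β : ℝ,
      ((-((κ₁ + μ₁) * (κ₂ + μ₁) / μ₁), -((κ₁ + μ₂) * (κ₂ + μ₂) / μ₂)) : ℝ × ℝ) =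
        α • ((-1, 0) : ℝ × ℝ) + β • ((κ₁ + μ₁, κ₁ + μ₂) : ℝ × ℝ) ↔
      α = -(κ₂ * (μ₁ - μ₂) * (κ₁ + μ₁) / (μ₁ * μ₂)) ∧ β = -((κ₂ + μ₂) / μ₂) := by
    intro α β
    simp only [Prod.smul_mk, Prod.mk_add_mk, Prod.mk.injEq, smul_eq_mul]
    constructor
    · rintro ⟨h₁, h₂⟩
      have hβ : β = -((κ₂ + μ₂) / μ₂) := by
        have hne : κ₁ + μ₂ ≠ 0 := by positivity
        apply mul_right_cancel₀ hne
        linear_combination -h₂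
      refine ⟨?_, hβ⟩
      have hα : α = β * (κ₁ + μ₁) + (κ₁ + μ₁) * (κ₂ + μ₁) / μ₁ := by linarith
      rw [hα, hβ]
      field_simp
      ring
    · rintro ⟨rfl, rfl⟩
      constructor <;> field_simp <;> ring
  have hβ : -((κ₂ + μ₂) / μ₂) < 0 := neg_neg_of_pos (by positivity)
  have hα : -(κ₂ * (μ₁ - μ₂) * (κ₁ + μ₁) / (μ₁ * μ₂)) ≤ 0 ↔ μ₂ ≤ μ₁ := by
    have hc : 0 < κ₂ * (κ₁ + μ₁) / (μ₁ * μ₂) := by positivity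
    rw [show κ₂ * (μ₁ - μ₂) * (κ₁ + μ₁) / (μ₁ * μ₂) =
      κ₂ * (κ₁ + μ₁) / (μ₁ * μ₂) * (μ₁ - μ₂) by ring, neg_nonpos,
      mul_nonneg_iff_of_pos_left hc, sub_nonneg]
  refine ⟨fun α β => (hrep α β).mp, hβ, hα, ?_, fun h => ?_⟩
  · rintro ⟨α, β, hα₀, -, h⟩
    exact hα.mp (((hrep α β).mp h).1 ▸ hα₀)
  · exact ⟨_, _, hα.mpr h, hβ.le, (hrep _ _).mpr ⟨rfl, rfl⟩⟩
end
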